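/- arXiv:2412.16848 — 2 statements merged into one kernel-verified Lean document; each statement's English description precedes it below -/
import Mathlib

section
/- Let S be a nonempty finite type, P : Matrix S S ℝ a row-stochastic matrix (all entries nonnegative and each row sums to 1), and γ ∈ (0,1). Let r, r̂, δ, e : S → ℝ with e i ≥ 0 and |r̂ i − r i| ≤ e i for all i. Suppose Q, Q̂ : S → ℝ satisfy Q = r + γ·P.mulVec Q and Q̂ = r̂ + γ·P.mulVec Q̂ − δ. Set R = (1 − γ•P)⁻¹, h = R.mulVec (−δ), and E = R.mulVec e. Then for all i ∈ S, Q̂ i − Q i ≤ h i + E i. -/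
open scoped Matrix

/-- Discounted maximum principle for a row-stochastic matrix. -/
theorem nonpos_of_le_discounted_mulVec {S : Type*} [Fintype S] {P : Matrix S S ℝ}
    (hP0 : ∀ i j, 0 ≤ P i j) (hP1 : ∀ i, ∑ j, P i j = 1)
    {γ : ℝ} (hγ0 : 0 ≤ γ) (hγ1 : γ < 1) {u : S → ℝ}
    (hu : ∀ i, u i ≤ γ * P.mulVec u i) (i : S) : u i ≤ 0 := by
  have : Nonempty S := ⟨i⟩
  obtain ⟨m, hm⟩ := Finite.exists_max u
  have hPm : P.mulVec u m ≤ u m := by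
    calc P.mulVec u m ≤ ∑ j, P m j * u m :=
          Finset.sum_le_sum fun j _ => mul_le_mul_of_nonneg_left (hm j) (hP0 m j)
      _ = u m := by rw [← Finset.sum_mul, hP1, one_mul]
  have hγm : γ * P.mulVec u m ≤ γ * u m := mul_le_mul_of_nonneg_left hPm hγ0
  have hum := hu m
  have : u m ≤ 0 := by nlinarith
  exact (hm i).trans this

theorem isUnit_one_sub_discounted {S : Type*} [Fintype S] [DecidableEq S] {P : Matrix S S ℝ}
    (hP0 : ∀ i j, 0 ≤ P i j) (hP1 : ∀ i, ∑ j, P i j = 1)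
    {γ : ℝ} (hγ0 : 0 ≤ γ) (hγ1 : γ < 1) : IsUnit (1 - γ • P) := by
  rw [← Matrix.mulVec_injective_iff_isUnit]
  have key : ∀ v w : S → ℝ, (1 - γ • P).mulVec v = (1 - γ • P).mulVec w → ∀ i, v i ≤ w i := by
    intro v w hvw i
    have hle : ∀ j, (v - w) j ≤ γ * P.mulVec (v - w) j := by
      intro j
      have := congrFun hvw j
      simp only [Matrix.sub_mulVec, Matrix.one_mulVec, Matrix.smul_mulVec, Matrix.mulVec_sub,
        Pi.sub_apply, Pi.smul_apply, smul_eq_mul] at this ⊢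
      linarith
    exact sub_nonpos.mp (nonpos_of_le_discounted_mulVec hP0 hP1 hγ0 hγ1 hle i)
  exact fun v w hvw => funext fun i => le_antisymm (key v w hvw i) (key w v hvw.symm i)

/-- Proposition IV.2, upper bound (Equation 7): Q̂ i − Q i ≤ h i + E i. -/
theorem aclql_gap_upper_bound
    (S : Type) [Fintype S] [Nonempty S] [DecidableEq S]
    (P : Matrix S S ℝ)
    (hP0 : ∀ i j, 0 ≤ P i j) (hP1 : ∀ i, ∑ j, P i j = 1)
    (γ : ℝ) (hγ : γ ∈ Set.Ioo (0 : ℝ) 1)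
    (r rhat δ e : S → ℝ)
    (he : ∀ i, 0 ≤ e i) (herr : ∀ i, |rhat i - r i| ≤ e i)
    (Q Qhat : S → ℝ)
    (hQ : ∀ i, Q i = r i + γ * P.mulVec Q i)
    (hQhat : ∀ i, Qhat i = rhat i + γ * P.mulVec Qhat i - δ i)
    (R : Matrix S S ℝ) (hR : R = (1 - γ • P)⁻¹)
    (h E : S → ℝ)
    (hh : h = R.mulVec (fun i => -δ i))
    (hE : E = R.mulVec e) :
    ∀ i, Qhat i - Q i ≤ h i + E i := by
  have hunit := isUnit_one_sub_discounted hP0 hP1 hγ.1.le hγ.2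
  have resolvent : ∀ v : S → ℝ, ∀ j, R.mulVec v j - γ * P.mulVec (R.mulVec v) j = v j := by
    intro v j
    have hv : (1 - γ • P).mulVec (R.mulVec v) = v := by
      rw [hR, Matrix.mulVec_mulVec,
        Matrix.mul_nonsing_inv _ ((Matrix.isUnit_iff_isUnit_det _).mp hunit), Matrix.one_mulVec]
    simpa only [Matrix.sub_mulVec, Matrix.one_mulVec, Matrix.smul_mulVec, Pi.sub_apply,
      Pi.smul_apply, smul_eq_mul] using congrFun hv j
  have hle : ∀ j, (Qhat - Q - (h + E)) j ≤ γ * P.mulVec (Qhat - Q - (h + E)) j := by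
    intro j
    have hhj := resolvent (fun i => -δ i) j
    have hEj := resolvent e j
    rw [← hh] at hhj
    rw [← hE] at hEj
    have hr := (abs_le.mp (herr j)).2
    have hQj := hQ j
    have hQhatj := hQhat j
    simp only [Matrix.mulVec_sub, Matrix.mulVec_add, Pi.sub_apply, Pi.add_apply]
    linarith
  intro i
  exact sub_nonpos.mp (nonpos_of_le_discounted_mulVec hP0 hP1 hγ.1.le hγ.2 hle i)
end

section
/- Let S be a nonempty finite type, P : Matrix S S ℝ a row-stochastic matrix (all entries nonnegative and each row sums to 1), and γ ∈ (0,1). Let r, r̂, δ, e : S → ℝ with e i ≥ 0 and |r̂ i − r i| ≤ e i for all i. Suppose Q, Q̂ : S → ℝ satisfy Q = r + γ·P.mulVec Q and Q̂ = r̂ + γ·P.mulVec Q̂ − δ. Set R = (1 − γ•P)⁻¹, h = R.mulVec (−δ), and E = R.mulVec e. (a) If h i ≥ E i for all i, then Q̂ i ≥ Q i for all i (the learned Q-function is more optimistic than the ordinary Q-function). (b) If h i ≤ −E i for all i, then Q̂ i ≤ Q i for all i (the learned Q-function is more conservative than the ordinary Q-function). -/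
open scoped Matrix

namespace Matrix

variable {S : Type*} [Fintype S] [DecidableEq S] {P : Matrix S S ℝ} {γ : ℝ}

theorem one_sub_smul_mulVec_apply (P : Matrix S S ℝ) (γ : ℝ) (x : S → ℝ) (i : S) :
    ((1 - γ • P) *ᵥ x) i = x i - γ * (P *ᵥ x) i := by
  simp [sub_mulVec, smul_mulVec]

/-- Minimum principle for a discounted row-stochastic matrix. -/
theorem nonneg_of_one_sub_smul_mulVec_nonneg
    (hP0 : ∀ i j, 0 ≤ P i j) (hP1 : ∀ i, ∑ j, P i j = 1) (hγ0 : 0 ≤ γ) (hγ1 : γ < 1)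
    {x : S → ℝ} (hx : 0 ≤ (1 - γ • P) *ᵥ x) : 0 ≤ x := by
  intro i
  have : Nonempty S := ⟨i⟩
  obtain ⟨m, hm⟩ := Finite.exists_min x
  have hmin : x m ≤ (P *ᵥ x) m := calc
    x m = ∑ j, P m j * x m := by rw [← Finset.sum_mul, hP1, one_mul]
    _ ≤ ∑ j, P m j * x j :=
      Finset.sum_le_sum fun j _ => mul_le_mul_of_nonneg_left (hm j) (hP0 m j)
  have hxm := hx m
  rw [one_sub_smul_mulVec_apply, Pi.zero_apply] at hxm
  have hle := mul_le_mul_of_nonneg_left hmin hγ0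
  have hm0 : 0 ≤ x m := by
    by_contra! hneg
    nlinarith
  exact hm0.trans (hm i)

theorem isUnit_one_sub_smul
    (hP0 : ∀ i j, 0 ≤ P i j) (hP1 : ∀ i, ∑ j, P i j = 1) (hγ0 : 0 ≤ γ) (hγ1 : γ < 1) :
    IsUnit (1 - γ • P) := by
  refine mulVec_injective_iff_isUnit.mp fun x y hxy => ?_
  have hxy : (1 - γ • P) *ᵥ x = (1 - γ • P) *ᵥ y := hxy
  apply le_antisymm <;> rw [← sub_nonneg] <;>
    refine nonneg_of_one_sub_smul_mulVec_nonneg hP0 hP1 hγ0 hγ1 ?_ <;>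
    simp [mulVec_sub, hxy]

end Matrix

/-- Proposition IV.2, claims 2) and 3): if h ≥ E entrywise then Q̂ ≥ Q
(optimism); if h ≤ −E entrywise then Q̂ ≤ Q (conservatism). -/
theorem aclql_optimism_conservatism
    (S : Type) [Fintype S] [Nonempty S] [DecidableEq S]
    (P : Matrix S S ℝ)
    (hP0 : ∀ i j, 0 ≤ P i j) (hP1 : ∀ i, ∑ j, P i j = 1)
    (γ : ℝ) (hγ : γ ∈ Set.Ioo (0 : ℝ) 1)
    (r rhat δ e : S → ℝ)
    (he : ∀ i, 0 ≤ e i) (herr : ∀ i, |rhat i - r i| ≤ e i)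
    (Q Qhat : S → ℝ)
    (hQ : ∀ i, Q i = r i + γ * P.mulVec Q i)
    (hQhat : ∀ i, Qhat i = rhat i + γ * P.mulVec Qhat i - δ i)
    (R : Matrix S S ℝ) (hR : R = (1 - γ • P)⁻¹)
    (h E : S → ℝ)
    (hh : h = R.mulVec (fun i => -δ i))
    (hE : E = R.mulVec e) :
    ((∀ i, h i ≥ E i) → ∀ i, Qhat i ≥ Q i) ∧
      ((∀ i, h i ≤ -E i) → ∀ i, Qhat i ≤ Q i) := by
  obtain ⟨hγ0, hγ1⟩ := hγ
  have hdet := (Matrix.isUnit_iff_isUnit_det _).mp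
    (Matrix.isUnit_one_sub_smul hP0 hP1 hγ0.le hγ1)
  have hresolvent (v : S → ℝ) : (1 - γ • P) *ᵥ (R *ᵥ v) = v := by
    rw [hR, Matrix.mulVec_mulVec, Matrix.mul_nonsing_inv _ hdet, Matrix.one_mulVec]
  have hMh : (1 - γ • P) *ᵥ h = fun i => -δ i := by rw [hh, hresolvent]
  have hME : (1 - γ • P) *ᵥ E = e := by rw [hE, hresolvent]
  have hMQ : (1 - γ • P) *ᵥ Q = r := by
    ext i
    rw [Matrix.one_sub_smul_mulVec_apply]
    linarith [hQ i]
  have hMQhat : (1 - γ • P) *ᵥ Qhat = fun i => rhat i - δ i := by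
    ext i
    rw [Matrix.one_sub_smul_mulVec_apply]
    linarith [hQhat i]
  have hlower : 0 ≤ Qhat - Q - h + E := by
    refine Matrix.nonneg_of_one_sub_smul_mulVec_nonneg hP0 hP1 hγ0.le hγ1 fun i => ?_
    simp only [Matrix.mulVec_add, Matrix.mulVec_sub, hMh, hME, hMQ, hMQhat,
      Pi.add_apply, Pi.sub_apply, Pi.zero_apply]
    linarith [(abs_le.mp (herr i)).1]
  have hupper : 0 ≤ h + E - (Qhat - Q) := by
    refine Matrix.nonneg_of_one_sub_smul_mulVec_nonneg hP0 hP1 hγ0.le hγ1 fun i => ?_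
    simp only [Matrix.mulVec_add, Matrix.mulVec_sub, hMh, hME, hMQ, hMQhat,
      Pi.add_apply, Pi.sub_apply, Pi.zero_apply]
    linarith [(abs_le.mp (herr i)).2]
  refine ⟨fun hopt i => ?_, fun hcons i => ?_⟩
  · have hi := hlower i
    simp only [Pi.add_apply, Pi.sub_apply, Pi.zero_apply] at hi
    linarith [hopt i]
  · have hi := hupper i
    simp only [Pi.add_apply, Pi.sub_apply, Pi.zero_apply] at hi
    linarith [hcons i]
end
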